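/- Let f : [0,T] × ℝⁿ → ℝⁿ satisfy Assumptions (ii) and (iii), let α > 0, and for 1 ≤ i ≤ m let A_i ∈ ℝ^{n×n} and C_i ∈ ℝ^{1×n} with B_i = α·C_iᵀ, D_i = 0, and Ker(C_i) ⊆ Ker(A_i). Then for every initial condition x₀ ∈ ℝⁿ the differential inclusion ẋ(t) ∈ f(t, x(t)) - Σ_{i=1}^m (A_i x(t) + B_i)·sgn(C_i x(t)) a.e. on (0,T), x(0) = x₀, has a unique Lipschitz solution x : [0,T] → ℝⁿ. -/

import Mathlib

open MeasureTheory Set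
open scoped RealInnerProductSpace

noncomputable section

/-- The set-valued sign function: `sgn(x) = {1}` if `x > 0`, `{-1}` if `x < 0`,
and `[-1,1]` if `x = 0`. -/
def sgnSet (x : ℝ) : Set ℝ := if 0 < x then {1} else if x < 0 then {-1} else Icc (-1) 1

/-- Matrix-vector product, as a map between Euclidean spaces. -/
def mv {m n : ℕ} (M : Matrix (Fin m) (Fin n) ℝ) (x : EuclideanSpace ℝ (Fin n)) :
    EuclideanSpace ℝ (Fin m) := WithLp.toLp 2 fun i => ∑ j, M i j * x j

/-- A Lipschitz solution on `[0,T]` of the differential inclusion `ẋ(t) ∈ F(t, x(t))`,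
`x(0) = x₀`. -/
def IsLipschitzSolution {E : Type*} [NormedAddCommGroup E] [NormedSpace ℝ E]
    (F : ℝ → E → Set E) (T : ℝ) (x₀ : E) (x : ℝ → E) : Prop :=
  (∃ K : NNReal, LipschitzOnWith K x (Icc 0 T)) ∧ x 0 = x₀ ∧
    ∀ᵐ t ∂volume, t ∈ Ioo 0 T → ∃ v ∈ F t (x t), HasDerivAt x v t

/-- Assumption (ii): `f` is Lipschitz in its second argument, uniformly in `t ∈ [0,T]`. -/
def AssumptionII {E : Type*} [NormedAddCommGroup E] (T : ℝ) (f : ℝ → E → E) : Prop :=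
  ∃ L : ℝ, 0 ≤ L ∧ ∀ t ∈ Icc (0 : ℝ) T, ∀ x₁ x₂ : E, ‖f t x₁ - f t x₂‖ ≤ L * ‖x₁ - x₂‖

/-- Assumption (iii): `f(·,x)` is differentiable in `t` and `Φ(R) < ∞` for every `R ≥ 0`. -/
def AssumptionIII {E : Type*} [NormedAddCommGroup E] [NormedSpace ℝ E]
    (T : ℝ) (f : ℝ → E → E) : Prop :=
  (∀ x : E, Differentiable ℝ fun t => f t x) ∧
  ∀ R : ℝ, 0 ≤ R → ∃ M : ℝ,
    ∀ v : ℝ → E, eLpNorm v 2 (volume.restrict (Ioo 0 T)) ≤ ENNReal.ofReal R →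
      eLpNorm (fun t => deriv (fun τ => f τ (v t)) t) 2 (volume.restrict (Ioo 0 T)) ≤
        ENNReal.ofReal M

/-- A set-valued map `F : ℝⁿ ⇉ ℝⁿ` is hypomonotone if for some constant `k ≥ 0`,
`⟨u - v, x - y⟩ ≥ -k‖x - y‖²` for all selections. -/
def Hypomonotone {n : ℕ}
    (F : EuclideanSpace ℝ (Fin n) → Set (EuclideanSpace ℝ (Fin n))) : Prop :=
  ∃ k : ℝ, 0 ≤ k ∧ ∀ x y u v : EuclideanSpace ℝ (Fin n),
    u ∈ F x → v ∈ F y → -(k * ‖x - y‖ ^ 2) ≤ ⟪u - v, x - y⟫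
open Filter Topology
open scoped NNReal

/-- Gronwall for absolutely continuous functions with an a.e. differential inequality. -/
lemma ae_gronwall {T K ε : ℝ} (hK : 0 ≤ K) (hε : 0 ≤ ε) {u : ℝ → ℝ}
    (hu : AbsolutelyContinuousOnInterval u 0 T) (h0 : u 0 = 0)
    (hd : ∀ᵐ t ∂volume, t ∈ Ioo 0 T → ∃ u', HasDerivAt u u' t ∧ u' ≤ K * u t + ε)
    {t : ℝ} (ht : t ∈ Icc 0 T) : u t ≤ ε * t * Real.exp (K * t) := by
  have hac : AbsolutelyContinuousOnInterval u 0 t := by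
    apply hu.mono
    rw [uIcc_of_le ht.1, uIcc_of_le (ht.1.trans ht.2)]
    exact Icc_subset_Icc_right ht.2
  have he : AbsolutelyContinuousOnInterval (fun s => Real.exp (-(K * s))) 0 t := by
    apply ContDiffOn.absolutelyContinuousOnInterval
    fun_prop
  have hl : AbsolutelyContinuousOnInterval (fun s => ε * s) 0 t := by
    apply ContDiffOn.absolutelyContinuousOnInterval
    fun_prop
  have hw := (he.mul hac).sub hl
  have hftc := hw.integral_deriv_eq_sub
  have hle : ∫ s in (0:ℝ)..t, deriv (((fun s => Real.exp (-(K * s))) * u) - fun s => ε * s) s ≤ 0 := by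
    have h0' : ∫ s in (0:ℝ)..t, (0:ℝ) = 0 := by simp
    refine le_of_le_of_eq ?_ h0'
    apply intervalIntegral.integral_mono_ae_restrict ht.1 hw.intervalIntegrable_deriv (by simp)
    rw [Filter.EventuallyLE, ae_restrict_iff' measurableSet_Icc]
    have hne1 : ∀ᵐ s : ℝ ∂volume, s ≠ 0 := by simp [ae_iff]
    have hne2 : ∀ᵐ s : ℝ ∂volume, s ≠ t := by simp [ae_iff]
    filter_upwards [hd, hne1, hne2] with s hs h1 h2 hmem
    have hs0 : 0 < s := lt_of_le_of_ne hmem.1 h1.symm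
    have hst : s < t := lt_of_le_of_ne hmem.2 h2
    obtain ⟨u', hu', hle⟩ := hs ⟨hs0, hst.trans_le ht.2⟩
    have hexp : HasDerivAt (fun s => Real.exp (-(K * s))) (Real.exp (-(K * s)) * (-(K * 1))) s :=
      (((hasDerivAt_id s).const_mul K).neg).exp
    have hlin : HasDerivAt (fun s : ℝ => ε * s) (ε * 1) s := (hasDerivAt_id s).const_mul ε
    have := (hexp.mul hu').sub hlin
    rw [this.deriv]
    have e1 : Real.exp (-(K * s)) ≤ 1 := Real.exp_le_one_iff.2 (by
      have := mul_nonneg hK hs0.le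
      linarith)
    have e0 := Real.exp_pos (-(K * s))
    have : Real.exp (-(K * s)) * u' ≤ Real.exp (-(K * s)) * (K * u s + ε) := by gcongr
    have : Real.exp (-(K * s)) * ε ≤ 1 * ε := by gcongr
    nlinarith
  rw [hftc] at hle
  simp only [Pi.sub_apply, Pi.mul_apply, h0] at hle
  have hle' : Real.exp (-(K * t)) * u t ≤ ε * t := by linarith
  calc u t = (Real.exp (-(K * t)) * u t) * Real.exp (K * t) := by
        rw [mul_right_comm, ← Real.exp_add]; simp
    _ ≤ _ := by gcongr

/-- Comparison of two Lipschitz curves with one-sided Lipschitz velocities. -/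
lemma compare_curves {E : Type*} [NormedAddCommGroup E] [InnerProductSpace ℝ E]
    {T L ε : ℝ} (hL : 0 ≤ L) (hε : 0 ≤ ε) {x y : ℝ → E} {K₁ K₂ : ℝ≥0}
    (hx : LipschitzOnWith K₁ x (Icc 0 T)) (hy : LipschitzOnWith K₂ y (Icc 0 T))
    (h0 : x 0 = y 0)
    (hd : ∀ᵐ t ∂volume, t ∈ Ioo 0 T → ∃ v w, HasDerivAt x v t ∧ HasDerivAt y w t ∧
      ⟪v - w, x t - y t⟫ ≤ L * ‖x t - y t‖ ^ 2 + ε)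
    {t : ℝ} (ht : t ∈ Icc 0 T) :
    ‖x t - y t‖ ^ 2 ≤ 2 * ε * t * Real.exp (2 * L * t) := by
  have hT : 0 ≤ T := ht.1.trans ht.2
  have hn : AbsolutelyContinuousOnInterval (fun s => ‖x s - y s‖) 0 T := by
    have h1 : LipschitzOnWith (K₁ + K₂) (fun s => x s - y s) (uIcc 0 T) := by
      rw [uIcc_of_le hT]
      exact hx.sub hy
    have := lipschitzWith_one_norm.comp_lipschitzOnWith h1
    exact this.absolutelyContinuousOnInterval
  refine ae_gronwall (u := fun s => ‖x s - y s‖ ^ 2) (T := T) (by positivity) (by positivity) ?_ (by simp [h0]) ?_ ht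
  · have := hn.mul hn
    convert! this using 1
    ext s
    simp [sq]
  · filter_upwards [hd] with s hs hmem
    obtain ⟨v, w, hv, hw, hle⟩ := hs hmem
    refine ⟨_, (hv.sub hw).norm_sq, ?_⟩
    rw [real_inner_comm, Pi.sub_apply]
    linarith

/-- Coordinatewise truncation. -/
def trunc {n : ℕ} (R : ℝ) (x : EuclideanSpace ℝ (Fin n)) : EuclideanSpace ℝ (Fin n) :=
  WithLp.toLp 2 fun i => max (-R) (min R (x i))

lemma trunc_lip {n : ℕ} (R : ℝ) : LipschitzWith 1 (trunc (n := n) R) := by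
  refine LipschitzWith.of_dist_le_mul fun x y => ?_
  rw [EuclideanSpace.dist_eq, EuclideanSpace.dist_eq]
  simp only [NNReal.coe_one, one_mul]
  gcongr with i
  simp only [trunc, Real.dist_eq]
  refine (abs_max_sub_max_le_max _ _ _ _).trans ?_
  simp only [sub_self, abs_zero]
  refine max_le (abs_nonneg _) ((abs_min_sub_min_le_max _ _ _ _).trans ?_)
  simp

lemma trunc_norm_le {n : ℕ} {R : ℝ} (hR : 0 ≤ R) (x : EuclideanSpace ℝ (Fin n)) :
    ‖trunc R x‖ ≤ ‖x‖ := by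
  have h := (trunc_lip (n := n) R).dist_le_mul x 0
  have h0 : trunc R (0 : EuclideanSpace ℝ (Fin n)) = 0 := by
    ext i; simp [trunc, hR]
  simpa [h0] using h

lemma trunc_bound {n : ℕ} {R : ℝ} (hR : 0 ≤ R) (x : EuclideanSpace ℝ (Fin n)) :
    ‖trunc R x‖ ≤ √(∑ _i : Fin n, R ^ 2) := by
  rw [EuclideanSpace.norm_eq]
  gcongr with i
  simp only [trunc, Real.norm_eq_abs]
  exact abs_le.2 ⟨le_max_left _ _, max_le (by linarith) (min_le_left _ _)⟩

lemma trunc_eq {n : ℕ} {R : ℝ} (x : EuclideanSpace ℝ (Fin n)) (hx : ‖x‖ ≤ R) :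
    trunc R x = x := by
  ext i
  have h : |x i| ≤ R := (PiLp.norm_apply_le x i).trans hx
  obtain ⟨h1, h2⟩ := abs_le.1 h
  simp [trunc, h1, h2]

/-- A priori bound. -/
lemma apriori {n : ℕ} {T : ℝ} {K M : ℝ} (hK : 0 ≤ K) (hM : 0 ≤ M)
    {h : ℝ → EuclideanSpace ℝ (Fin n) → EuclideanSpace ℝ (Fin n)}
    (hb : ∀ t ∈ Icc 0 T, ∀ x, ‖h t x‖ ≤ K * ‖x‖ + M) {x : ℝ → EuclideanSpace ℝ (Fin n)}
    (hx : ∀ t ∈ Icc 0 T, HasDerivWithinAt x (h t (x t)) (Icc 0 T) t) :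
    ∀ t ∈ Icc 0 T, ‖x t‖ ≤ gronwallBound ‖x 0‖ K M T := by
  intro t ht
  have := norm_le_gronwallBound_of_norm_deriv_right_le (f := x) (f' := fun t => h t (x t))
    (δ := ‖x 0‖) (K := K) (ε := M) (a := 0) (b := T)
    (fun t ht => (hx t ht).continuousWithinAt)
    (fun t ht => by
      refine (hx t (Ico_subset_Icc_self ht)).mono_of_mem_nhdsWithin ?_
      exact mem_of_superset (Icc_mem_nhdsGE ht.2) (Icc_subset_Icc_left ht.1)) le_rfl
    (fun t ht => hb t (Ico_subset_Icc_self ht) _) t ht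
  refine this.trans (gronwallBound_mono (norm_nonneg _) hM hK ?_)
  simpa using ht.2

/-- Global existence for ODEs with a globally Lipschitz right hand side. -/
lemma global_ode {n : ℕ} {T : ℝ} (hT : 0 < T) (K : ℝ≥0)
    (h : ℝ → EuclideanSpace ℝ (Fin n) → EuclideanSpace ℝ (Fin n))
    (hlip : ∀ t, LipschitzWith K (h t)) (hc : ∀ x, Continuous fun t => h t x)
    (x₀ : EuclideanSpace ℝ (Fin n)) :
    ∃ x : ℝ → EuclideanSpace ℝ (Fin n), x 0 = x₀ ∧
      ∀ t ∈ Icc 0 T, HasDerivWithinAt x (h t (x t)) (Icc 0 T) t := by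
  obtain ⟨M, hM⟩ := isCompact_Icc.exists_bound_of_continuousOn (s := Icc 0 T) (hc 0).continuousOn
  have hM0 : 0 ≤ M := (norm_nonneg _).trans (hM 0 ⟨le_rfl, hT.le⟩)
  have hb : ∀ t ∈ Icc 0 T, ∀ x, ‖h t x‖ ≤ K * ‖x‖ + M := by
    intro t ht x
    have h1 := (hlip t).norm_sub_le x 0
    have h2 := hM t ht
    have h3 := norm_sub_norm_le (h t x) (h t 0)
    rw [sub_zero] at h1
    linarith
  set R := gronwallBound ‖x₀‖ K M T with hRdef
  have hR : 0 ≤ R := by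
    have := gronwallBound_mono (norm_nonneg x₀) hM0 K.2 hT.le
    rw [gronwallBound_x0] at this
    exact (norm_nonneg _).trans this
  set C : ℝ≥0 := ⟨K * √(∑ _i : Fin n, R ^ 2) + M, by positivity⟩ with hC
  have hPL : IsPicardLindelof (fun t x => h t (trunc R x)) (tmin := 0) (tmax := T)
      ⟨0, le_rfl, hT.le⟩ x₀ (C * ⟨T, hT.le⟩) 0 C K := by
    refine ⟨fun t ht => ?_, fun x hx => (hc _).continuousOn, fun t ht x hx => ?_, ?_⟩
    · have h1 := ((hlip t).comp (trunc_lip R)).lipschitzOnWith (s := Metric.closedBall x₀ (C * ⟨T, hT.le⟩ : ℝ≥0))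
      rw [mul_one] at h1
      exact h1
    · refine (hb t ht _).trans ?_
      change _ ≤ K * √(∑ _i : Fin n, R ^ 2) + M
      gcongr
      exact trunc_bound hR x
    · simp only [sub_zero, sub_self, NNReal.coe_zero]
      rw [max_eq_left hT.le]
      exact le_rfl
  obtain ⟨x, hx0, hx⟩ := hPL.exists_eq_forall_mem_Icc_hasDerivWithinAt₀
  have hx0' : x 0 = x₀ := hx0
  have hbd := apriori (T := T) (K := K) (M := M) K.2 hM0 (h := fun t x => h t (trunc R x))
    (fun t ht x => (hb t ht _).trans (by gcongr; exact trunc_norm_le hR x)) hx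
  refine ⟨x, hx0', fun t ht => ?_⟩
  have := hx t ht
  have hle := hbd t ht
  rw [hx0'] at hle
  rwa [trunc_eq _ hle] at this

/-- Saturation: Yosida approximation of the sign. -/
def sat (k r : ℝ) : ℝ := max (-1) (min 1 (k * r))

lemma sat_mem (k r : ℝ) : sat k r ∈ Icc (-1 : ℝ) 1 :=
  ⟨le_max_left _ _, max_le (by norm_num) (min_le_left _ _)⟩

lemma sat_aux {k : ℝ} (hk : 0 < k) (r b : ℝ) (hb : b ∈ Icc (-1 : ℝ) 1) :
    0 ≤ (sat k r - b) * (r - sat k r / k) := by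
  obtain ⟨hb1, hb2⟩ := hb
  rcases le_total 1 (k * r) with h | h
  · have : sat k r = 1 := by simp [sat, h]
    rw [this]
    have : 1 / k ≤ r := by rw [div_le_iff₀ hk]; linarith
    exact mul_nonneg (by linarith) (by linarith)
  · rcases le_total (k * r) (-1) with h' | h'
    · have : sat k r = -1 := by simp [sat, h, h']
      rw [this]
      have : r ≤ -1 / k := by rw [le_div_iff₀ hk]; linarith
      exact mul_nonneg_of_nonpos_of_nonpos (by linarith) (by linarith)
    · have : sat k r = k * r := by simp [sat, h, h']
      rw [this, mul_div_cancel_left₀ _ hk.ne']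
      simp

lemma sat_diff {k l : ℝ} (hk : 0 < k) (hl : 0 < l) (r q : ℝ) :
    -(2 * (1 / k + 1 / l)) ≤ (sat k r - sat l q) * (r - q) := by
  have h1 := sat_aux hk r _ (sat_mem l q)
  have h2 := sat_aux hl q _ (sat_mem k r)
  obtain ⟨ha1, ha2⟩ := sat_mem k r
  obtain ⟨hb1, hb2⟩ := sat_mem l q
  generalize sat k r = a at *
  generalize sat l q = b at *
  have hk' : 0 < 1 / k := by positivity
  have hl' : 0 < 1 / l := by positivity
  rw [div_eq_mul_one_div] at h1 h2
  have h3 : -2 ≤ (a - b) * a := by nlinarith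
  have h4 : -2 ≤ (b - a) * b := by nlinarith
  nlinarith [mul_le_mul_of_nonneg_right h3 hk'.le, mul_le_mul_of_nonneg_right h4 hl'.le]

lemma sat_lip {k : ℝ} (hk : 0 ≤ k) (r q : ℝ) : |sat k r - sat k q| ≤ k * |r - q| := by
  refine (abs_max_sub_max_le_max _ _ _ _).trans ?_
  simp only [sub_self, abs_zero]
  refine max_le (by positivity) ((abs_min_sub_min_le_max _ _ _ _).trans ?_)
  simp only [sub_self, abs_zero]
  refine max_le (by positivity) ?_
  rw [← mul_sub, abs_mul, abs_of_nonneg hk]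

lemma sgnSet_pos {r : ℝ} (h : 0 < r) : sgnSet r = {1} := by simp [sgnSet, h]
lemma sgnSet_neg {r : ℝ} (h : r < 0) : sgnSet r = {-1} := by simp [sgnSet, h, h.le]
lemma sgnSet_zero : sgnSet 0 = Icc (-1) 1 := by simp [sgnSet]

lemma sgnSet_subset {a r : ℝ} (h : a ∈ sgnSet r) : a ∈ Icc (-1 : ℝ) 1 ∧ a * r = |r| := by
  rcases lt_trichotomy r 0 with hr | hr | hr
  · rw [sgnSet_neg hr, mem_singleton_iff] at h
    subst h
    rw [abs_of_neg hr]; norm_num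
  · subst hr
    rw [sgnSet_zero] at h
    exact ⟨h, by simp⟩
  · rw [sgnSet_pos hr, mem_singleton_iff] at h
    subst h
    rw [abs_of_pos hr]; norm_num

lemma sgnSet_mono {a b r q : ℝ} (ha : a ∈ sgnSet r) (hb : b ∈ sgnSet q) :
    0 ≤ (a - b) * (r - q) := by
  obtain ⟨⟨a1, a2⟩, a3⟩ := sgnSet_subset ha
  obtain ⟨⟨b1, b2⟩, b3⟩ := sgnSet_subset hb
  have h1 : a * q ≤ |q| := by
    rcases abs_cases q with ⟨h, _⟩ | ⟨h, _⟩ <;> nlinarith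
  have h2 : b * r ≤ |r| := by
    rcases abs_cases r with ⟨h, _⟩ | ⟨h, _⟩ <;> nlinarith
  nlinarith

lemma sgnSet_compact (r : ℝ) : IsCompact (sgnSet r) := by
  unfold sgnSet
  split_ifs
  · exact isCompact_singleton
  · exact isCompact_singleton
  · exact isCompact_Icc

lemma sgnSet_convex (r : ℝ) : Convex ℝ (sgnSet r) := by
  unfold sgnSet
  split_ifs
  · exact convex_singleton _
  · exact convex_singleton _
  · exact convex_Icc _ _

/-- Along a filter, saturations eventually lie in the limiting sign set. -/
lemma sat_eventually {ι : Type*} {F : Filter ι} {κ ρ : ι → ℝ} {r : ℝ}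
    (hκ : Tendsto κ F atTop) (hρ : Tendsto ρ F (𝓝 r)) :
    ∀ᶠ j in F, sat (κ j) (ρ j) ∈ sgnSet r := by
  rcases lt_trichotomy r 0 with hr | hr | hr
  · filter_upwards [(hκ.atTop_mul_neg hr hρ).eventually_le_atBot (-1)] with j hj
    rw [sgnSet_neg hr]
    have : min 1 (κ j * ρ j) ≤ -1 := (min_le_right _ _).trans hj
    simp [sat, this]
  · subst hr
    rw [sgnSet_zero]
    exact Eventually.of_forall fun j => sat_mem _ _
  · filter_upwards [(hκ.atTop_mul_pos hr hρ).eventually_ge_atTop 1] with j hj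
    rw [sgnSet_pos hr]
    simp [sat, hj]

/-- Identification of the derivative of the limit curve. -/
lemma limit_inclusion {n m : ℕ} {T : ℝ}
    {g : ℝ → EuclideanSpace ℝ (Fin n) → EuclideanSpace ℝ (Fin n)}
    (hg : Continuous fun q : ℝ × EuclideanSpace ℝ (Fin n) => g q.1 q.2)
    (c b : Fin m → EuclideanSpace ℝ (Fin n))
    (X : ℕ → ℝ → EuclideanSpace ℝ (Fin n)) (x : ℝ → EuclideanSpace ℝ (Fin n))
    (hX : ∀ k, ∀ t ∈ Ioo 0 T, HasDerivAt (X k)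
      (g t (X k t) - ∑ i, sat ((k : ℝ) + 1) ⟪c i, X k t⟫ • b i) t)
    (hlim : TendstoUniformlyOn X x atTop (Icc 0 T))
    {t : ℝ} (ht : t ∈ Ioo 0 T) {v : EuclideanSpace ℝ (Fin n)} (hv : HasDerivAt x v t) :
    ∃ σ : Fin m → ℝ, (∀ i, σ i ∈ sgnSet ⟪c i, x t⟫) ∧ v = g t (x t) - ∑ i, σ i • b i := by
  by_contra hcon
  let Ψ : (Fin m → ℝ) → EuclideanSpace ℝ (Fin n) := fun σ => g t (x t) - ∑ i, σ i • b i
  let S : Set (Fin m → ℝ) := Set.pi univ fun i => sgnSet ⟪c i, x t⟫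
  have hScomp : IsCompact S := isCompact_univ_pi fun i => sgnSet_compact _
  have hSconv : Convex ℝ S := convex_pi fun i _ => sgnSet_convex _
  have hΨc : Continuous Ψ := by fun_prop
  have hKcl : IsClosed (Ψ '' S) := (hScomp.image hΨc).isClosed
  have hKconv : Convex ℝ (Ψ '' S) := by
    rintro _ ⟨σ, hσ, rfl⟩ _ ⟨τ, hτ, rfl⟩ p q hp hq hpq
    refine ⟨p • σ + q • τ, hSconv hσ hτ hp hq hpq, ?_⟩
    simp only [Ψ, Pi.add_apply, Pi.smul_apply, smul_eq_mul, add_smul, mul_smul,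
      Finset.sum_add_distrib, smul_sub, ← Finset.smul_sum]
    have : g t (x t) = p • g t (x t) + q • g t (x t) := by rw [← add_smul, hpq, one_smul]
    nth_rw 1 [this]
    abel
  have hvK : v ∉ Ψ '' S := by
    rintro ⟨σ, hσ, h⟩
    exact hcon ⟨σ, fun i => hσ i (mem_univ i), h.symm⟩
  obtain ⟨p, u, hpu, hup⟩ := geometric_hahn_banach_closed_point hKconv hKcl hvK
  set η := (p v - u) / 2 with hη
  have hηpos : 0 < η := by rw [hη]; linarith
  have hIcc : Icc 0 T ∈ 𝓝 t := Icc_mem_nhds ht.1 ht.2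
  have hsnd : Tendsto (fun q : ℕ × ℝ => q.2) (atTop ×ˢ 𝓝 t) (𝓝 t) := tendsto_snd
  have hfst : Tendsto (fun q : ℕ × ℝ => ((q.1 : ℕ) : ℝ) + 1) (atTop ×ˢ 𝓝 t) atTop :=
    (tendsto_atTop_add_const_right _ _ tendsto_natCast_atTop_atTop).comp tendsto_fst
  have hXlim : Tendsto (fun q : ℕ × ℝ => X q.1 q.2) (atTop ×ˢ 𝓝 t) (𝓝 (x t)) := by
    rw [Metric.tendsto_nhds]
    intro ε hε
    have h1 := Metric.tendstoUniformlyOn_iff.1 hlim (ε / 2) (by positivity)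
    have h2 := Metric.tendsto_nhds.1 hv.continuousAt.tendsto (ε / 2) (by positivity)
    filter_upwards [tendsto_fst.eventually h1, hsnd.eventually h2, hsnd.eventually hIcc]
      with q q1 q2 q3
    have := q1 q.2 q3
    have h4 := dist_triangle_left (X q.1 q.2) (x t) (x q.2)
    linarith
  have hgl : Tendsto (fun q : ℕ × ℝ => p (g q.2 (X q.1 q.2))) (atTop ×ˢ 𝓝 t)
      (𝓝 (p (g t (x t)))) := by
    have := (p.continuous.comp hg).tendsto (t, x t)
    exact this.comp (hsnd.prodMk_nhds hXlim)
  have hsat : ∀ᶠ q in (atTop : Filter ℕ) ×ˢ 𝓝 t,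
      ∀ i, sat ((q.1 : ℝ) + 1) ⟪c i, X q.1 q.2⟫ ∈ sgnSet ⟪c i, x t⟫ := by
    rw [eventually_all]
    intro i
    exact sat_eventually hfst (tendsto_const_nhds.inner hXlim)
  have hev : ∀ᶠ q in (atTop : Filter ℕ) ×ˢ 𝓝 t,
      p (g q.2 (X q.1 q.2) - ∑ i, sat ((q.1 : ℝ) + 1) ⟪c i, X q.1 q.2⟫ • b i) ≤ u + η := by
    filter_upwards [hsat, hgl.eventually_lt_const (show p (g t (x t)) < p (g t (x t)) + η by linarith)]
      with q q1 q2
    have h3 := hpu _ ⟨_, fun i _ => q1 i, rfl⟩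
    simp only [Ψ, map_sub] at h3 ⊢
    linarith
  obtain ⟨pa, hpa, pb, hpb, hab⟩ := eventually_prod_iff.1 hev
  obtain ⟨l, r, htr, hsub⟩ := mem_nhds_iff_exists_Ioo_subset.1
    (inter_mem hpb (Ioo_mem_nhds ht.1 ht.2))
  have key : ∀ s ∈ Ioo t r, p (x s) - p (x t) ≤ (u + η) * (s - t) := by
    intro s hs
    have hmem : ∀ s' ∈ Icc t s, pb s' ∧ s' ∈ Ioo 0 T := fun s' hs' =>
      hsub ⟨htr.1.trans_le hs'.1, hs'.2.trans_lt hs.2⟩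
    have hk : ∀ᶠ k in atTop, p (X k s) - p (X k t) ≤ (u + η) * (s - t) := by
      filter_upwards [hpa] with k hk
      have hder : ∀ s' ∈ Icc t s, HasDerivAt (fun s => p (X k s))
          (p (g s' (X k s') - ∑ i, sat ((k : ℝ) + 1) ⟪c i, X k s'⟫ • b i)) s' := fun s' hs' =>
        p.hasFDerivAt.comp_hasDerivAt s' (hX k s' (hmem s' hs').2)
      refine (convex_Icc t s).image_sub_le_mul_sub_of_deriv_le
        (fun s' hs' => (hder s' hs').continuousAt.continuousWithinAt)
        (fun s' hs' => (hder s' (interior_subset hs')).differentiableAt.differentiableWithinAt)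
        (fun s' hs' => ?_) t ⟨le_rfl, hs.1.le⟩ s ⟨hs.1.le, le_rfl⟩ hs.1.le
      rw [(hder s' (interior_subset hs')).deriv]
      exact hab hk (hmem s' (interior_subset hs')).1
    have hlims : ∀ s' ∈ Icc t s, Tendsto (fun k => p (X k s')) atTop (𝓝 (p (x s'))) := fun s' hs' =>
      (p.continuous.tendsto _).comp (hlim.tendsto_at (Ioo_subset_Icc_self (hmem s' hs').2))
    exact le_of_tendsto ((hlims s ⟨hs.1.le, le_rfl⟩).sub (hlims t ⟨le_rfl, hs.1.le⟩)) hk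
  have hpx : HasDerivAt (fun s => p (x s)) (p v) t := p.hasFDerivAt.comp_hasDerivAt t hv
  have hslope := (hasDerivAt_iff_tendsto_slope.1 hpx).mono_left
    (nhdsWithin_mono t (fun s (hs : s ∈ Ioi t) => (ne_of_gt hs : s ≠ t)))
  have : p v ≤ u + η := by
    refine le_of_tendsto hslope ?_
    filter_upwards [Ioo_mem_nhdsGT htr.2] with s hs
    rw [slope_def_field, div_le_iff₀ (by linarith [hs.1])]
    exact key s hs
  rw [hη] at this
  linarith

lemma exists_sol {n m : ℕ} {T : ℝ} (hT : 0 < T) (L : ℝ≥0)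
    (g : ℝ → EuclideanSpace ℝ (Fin n) → EuclideanSpace ℝ (Fin n))
    (hlip : ∀ t, LipschitzWith L (g t)) (hc : ∀ x, Continuous fun t => g t x)
    {α : ℝ} (hα : 0 < α) (c : Fin m → EuclideanSpace ℝ (Fin n))
    (x₀ : EuclideanSpace ℝ (Fin n)) :
    ∃ x : ℝ → EuclideanSpace ℝ (Fin n), (∃ K : ℝ≥0, LipschitzOnWith K x (Icc 0 T)) ∧ x 0 = x₀ ∧
      ∀ᵐ t ∂volume, t ∈ Ioo 0 T → ∃ σ : Fin m → ℝ, (∀ i, σ i ∈ sgnSet ⟪c i, x t⟫) ∧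
        HasDerivAt x (g t (x t) - ∑ i, σ i • (α • c i)) t := by
  have hg : Continuous fun q : ℝ × EuclideanSpace ℝ (Fin n) => g q.1 q.2 :=
    continuous_prod_of_continuous_lipschitzWith' _ L hlip hc
  obtain ⟨M, hM⟩ := isCompact_Icc.exists_bound_of_continuousOn (s := Icc 0 T) (hc 0).continuousOn
  have hM0 : 0 ≤ M := (norm_nonneg _).trans (hM 0 ⟨le_rfl, hT.le⟩)
  let h : ℕ → ℝ → EuclideanSpace ℝ (Fin n) → EuclideanSpace ℝ (Fin n) := fun k t x =>
    g t x - ∑ i, sat ((k : ℝ) + 1) ⟪c i, x⟫ • (α • c i)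
  have hhlip : ∀ (k : ℕ) t, LipschitzWith (L + ∑ i, ((k : ℝ≥0) + 1) * ‖c i‖₊ * ‖α • c i‖₊) (h k t) := by
    intro k t
    refine (hlip t).sub (LipschitzWith.of_dist_le_mul fun x y => ?_)
    rw [dist_eq_norm, dist_eq_norm, ← Finset.sum_sub_distrib]
    push_cast
    rw [Finset.sum_mul]
    refine (norm_sum_le _ _).trans (Finset.sum_le_sum fun i _ => ?_)
    rw [← sub_smul, norm_smul, Real.norm_eq_abs]
    have h1 := sat_lip (k := (k : ℝ) + 1) (by positivity) ⟪c i, x⟫ ⟪c i, y⟫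
    have h2 : |⟪c i, x⟫ - ⟪c i, y⟫| ≤ ‖c i‖ * ‖x - y‖ := by
      rw [← inner_sub_right]
      exact abs_real_inner_le_norm _ _
    calc _ ≤ (((k : ℝ) + 1) * (‖c i‖ * ‖x - y‖)) * ‖α • c i‖ := by
          gcongr
          exact h1.trans (by gcongr)
      _ = _ := by ring
  have hhc : ∀ k x, Continuous fun t => h k t x := fun k x => (hc x).sub continuous_const
  choose X hX0 hX using fun k => global_ode hT _ (h k) (hhlip k) (hhc k) x₀
  set M' := M + ∑ i, ‖α • c i‖ with hM'
  have hM'0 : 0 ≤ M' := by positivity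
  have hhb : ∀ k, ∀ t ∈ Icc 0 T, ∀ x, ‖h k t x‖ ≤ L * ‖x‖ + M' := by
    intro k t ht x
    have h1 := (hlip t).norm_sub_le x 0
    have h2 := hM t ht
    have h3 := norm_sub_norm_le (g t x) (g t 0)
    rw [sub_zero] at h1
    have h4 : ‖∑ i, sat ((k : ℝ) + 1) ⟪c i, x⟫ • (α • c i)‖ ≤ ∑ i, ‖α • c i‖ := by
      refine (norm_sum_le _ _).trans (Finset.sum_le_sum fun i _ => ?_)
      rw [norm_smul, Real.norm_eq_abs]
      exact mul_le_of_le_one_left (norm_nonneg _) (abs_le.2 (sat_mem _ _))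
    have h5 := norm_sub_le (g t x) (∑ i, sat ((k : ℝ) + 1) ⟪c i, x⟫ • (α • c i))
    have h6 : h k t x = g t x - ∑ i, sat ((k : ℝ) + 1) ⟪c i, x⟫ • (α • c i) := rfl
    rw [h6]
    linarith
  set R := gronwallBound ‖x₀‖ L M' T with hR
  have hXb : ∀ k, ∀ t ∈ Icc 0 T, ‖X k t‖ ≤ R := by
    intro k t ht
    have := apriori L.2 hM'0 (hhb k) (hX k) t ht
    rwa [hX0 k] at this
  have hR0 : 0 ≤ R := (norm_nonneg _).trans (hXb 0 0 ⟨le_rfl, hT.le⟩)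
  set C : ℝ≥0 := ⟨L * R + M', by positivity⟩ with hC
  have hXlip : ∀ k, LipschitzOnWith C (X k) (Icc 0 T) := by
    intro k
    refine (convex_Icc 0 T).lipschitzOnWith_of_nnnorm_hasDerivWithin_le (hX k) fun t ht => ?_
    rw [← NNReal.coe_le_coe]
    refine (hhb k t ht _).trans ?_
    change _ ≤ L * R + M'
    gcongr
    exact hXb k t ht
  have hXd : ∀ k, ∀ t ∈ Ioo 0 T, HasDerivAt (X k) (h k t (X k t)) t := fun k t ht =>
    (hX k t (Ioo_subset_Icc_self ht)).hasDerivAt (Icc_mem_nhds ht.1 ht.2)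
  set D : ℝ := 2 * (2 * α * m) * T * Real.exp (2 * L * T) with hD
  have hD0 : 0 ≤ D := by positivity
  have hcau : ∀ k l, ∀ t ∈ Icc 0 T,
      ‖X k t - X l t‖ ^ 2 ≤ D * (1 / ((k : ℝ) + 1) + 1 / ((l : ℝ) + 1)) := by
    intro k l t ht
    have hcomp := compare_curves (L := L) (ε := 2 * α * m * (1 / ((k : ℝ) + 1) + 1 / ((l : ℝ) + 1)))
      L.2 (by positivity) (hXlip k) (hXlip l) ((hX0 k).trans (hX0 l).symm)
      (Eventually.of_forall fun s hs => ⟨_, _, hXd k s hs, hXd l s hs, ?_⟩) ht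
    · refine hcomp.trans ?_
      calc _ ≤ 2 * (2 * α * m * (1 / ((k : ℝ) + 1) + 1 / ((l : ℝ) + 1))) * T *
            Real.exp (2 * L * T) := by
            have := ht.1
            have := ht.2
            gcongr
        _ = _ := by rw [hD]; ring
    · have e : h k s (X k s) - h l s (X l s) = (g s (X k s) - g s (X l s)) -
          ∑ i, (sat ((k : ℝ) + 1) ⟪c i, X k s⟫ - sat ((l : ℝ) + 1) ⟪c i, X l s⟫) • (α • c i) := by
        simp only [h, sub_smul, Finset.sum_sub_distrib]
        abel
      rw [e, inner_sub_left, sum_inner]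
      have h1 : ⟪g s (X k s) - g s (X l s), X k s - X l s⟫ ≤ L * ‖X k s - X l s‖ ^ 2 := by
        refine (real_inner_le_norm _ _).trans ?_
        rw [sq, ← mul_assoc]
        gcongr
        exact (hlip s).norm_sub_le _ _
      have h2 : ∑ _i : Fin m, -(2 * α * (1 / ((k : ℝ) + 1) + 1 / ((l : ℝ) + 1))) ≤
          ∑ i, ⟪(sat ((k : ℝ) + 1) ⟪c i, X k s⟫ - sat ((l : ℝ) + 1) ⟪c i, X l s⟫) • (α • c i),
            X k s - X l s⟫ := by
        refine Finset.sum_le_sum fun i _ => ?_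
        rw [real_inner_smul_left, real_inner_smul_left, inner_sub_right]
        have := sat_diff (k := (k : ℝ) + 1) (l := (l : ℝ) + 1) (by positivity) (by positivity)
          ⟪c i, X k s⟫ ⟪c i, X l s⟫
        nlinarith
      simp only [Finset.sum_const, Finset.card_univ, Fintype.card_fin, nsmul_eq_mul] at h2
      linarith
  have hDlim : Tendsto (fun N : ℕ => √(D * (1 / ((N : ℝ) + 1) + 1 / ((N : ℝ) + 1)))) atTop (𝓝 0) := by
    have h1 := tendsto_one_div_add_atTop_nhds_zero_nat (𝕜 := ℝ)
    have h2 := ((h1.add h1).const_mul D).sqrt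
    simpa using h2
  have hUC : ∀ t ∈ Icc 0 T, ∀ p q N : ℕ, N ≤ p → N ≤ q →
      dist (X p t) (X q t) ≤ √(D * (1 / ((N : ℝ) + 1) + 1 / ((N : ℝ) + 1))) := by
    intro t ht p q N hp hq
    rw [dist_eq_norm]
    refine Real.le_sqrt_of_sq_le ((hcau p q t ht).trans ?_)
    have : (N : ℝ) ≤ p := by exact_mod_cast hp
    have : (N : ℝ) ≤ q := by exact_mod_cast hq
    gcongr
  have hex : ∀ t, ∃ z, t ∈ Icc 0 T → Tendsto (fun k => X k t) atTop (𝓝 z) := by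
    intro t
    by_cases ht : t ∈ Icc 0 T
    · obtain ⟨z, hz⟩ := cauchySeq_tendsto_of_complete
        (cauchySeq_of_le_tendsto_0 _ (hUC t ht) hDlim)
      exact ⟨z, fun _ => hz⟩
    · exact ⟨0, fun h => absurd h ht⟩
  choose x hx using hex
  have hunif : TendstoUniformlyOn X x atTop (Icc 0 T) := by
    rw [Metric.tendstoUniformlyOn_iff]
    intro ε hε
    filter_upwards [hDlim.eventually_lt_const hε] with N hN t ht
    refine lt_of_le_of_lt ?_ hN
    refine le_of_tendsto ((hx t ht).dist tendsto_const_nhds) ?_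
    filter_upwards [eventually_ge_atTop N] with k hk
    exact hUC t ht k N N hk le_rfl
  have hxlip : LipschitzOnWith C x (Icc 0 T) := by
    refine LipschitzOnWith.of_dist_le_mul fun s hs t ht => ?_
    exact le_of_tendsto ((hx s hs).dist (hx t ht))
      (Eventually.of_forall fun k => (hXlip k).dist_le_mul s hs t ht)
  refine ⟨x, ⟨C, hxlip⟩, ?_, ?_⟩
  · have h1 := hx 0 ⟨le_rfl, hT.le⟩
    simp only [hX0] at h1
    exact tendsto_nhds_unique h1 tendsto_const_nhds
  · filter_upwards [hxlip.ae_differentiableWithinAt_of_mem_real] with t ht hmem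
    have hd := ((ht (Ioo_subset_Icc_self hmem)).differentiableAt
      (Icc_mem_nhds hmem.1 hmem.2)).hasDerivAt
    obtain ⟨σ, h1, h2⟩ := limit_inclusion hg c (fun i => α • c i) X x hXd hunif hmem hd
    exact ⟨σ, h1, h2 ▸ hd⟩

lemma kernel_factor {n : ℕ} (A : Matrix (Fin n) (Fin n) ℝ) (c : EuclideanSpace ℝ (Fin n))
    (hK : ∀ v : EuclideanSpace ℝ (Fin n), ⟪c, v⟫ = 0 → mv A v = 0) :
    ∃ a : EuclideanSpace ℝ (Fin n), ∀ v, mv A v = ⟪c, v⟫ • a := by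
  have hsub : ∀ v w, mv A (v - w) = mv A v - mv A w := by
    intro v w; ext i; simp [mv, mul_sub]
  have hsmul : ∀ (r : ℝ) v, mv A (r • v) = r • mv A v := by
    intro r v; ext i; simp [mv, Finset.mul_sum, mul_left_comm]
  by_cases hc : c = 0
  · refine ⟨0, fun v => ?_⟩
    rw [smul_zero]
    exact hK v (by simp [hc])
  · refine ⟨(‖c‖ ^ 2)⁻¹ • mv A c, fun v => ?_⟩
    have hn : ‖c‖ ^ 2 ≠ 0 := by positivity
    have h1 := hK (v - (⟪c, v⟫ * (‖c‖ ^ 2)⁻¹) • c) (by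
      rw [inner_sub_right, real_inner_smul_right, real_inner_self_eq_norm_sq]
      field_simp
      ring)
    rw [hsub, hsmul, sub_eq_zero] at h1
    rw [h1, mul_smul]

/-- Well-posedness of `ẋ(t) ∈ f(t,x(t)) - Σᵢ (Aᵢx(t) + Bᵢ)·sgn(Cᵢx(t))` when
`Bᵢ = α·Cᵢᵀ` with `α > 0`, `Dᵢ = 0` and `Ker(Cᵢ) ⊆ Ker(Aᵢ)`: there is a unique Lipschitz
solution on `[0,T]` for every initial condition. (The row `Cᵢ ∈ ℝ^{1×n}` is represented
by the vector `c i`, so that `Bᵢ = α • c i`.) -/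
theorem kernel_condition_inclusion_existsUnique_lipschitzSolution
    (n m : ℕ) (T : ℝ) (hT : 0 < T)
    (f : ℝ → EuclideanSpace ℝ (Fin n) → EuclideanSpace ℝ (Fin n))
    (hfII : AssumptionII T f) (hfIII : AssumptionIII T f)
    (α : ℝ) (hα : 0 < α)
    (A : Fin m → Matrix (Fin n) (Fin n) ℝ) (c : Fin m → EuclideanSpace ℝ (Fin n))
    (hKer : ∀ i : Fin m, ∀ v : EuclideanSpace ℝ (Fin n), ⟪c i, v⟫ = 0 → mv (A i) v = 0)
    (x₀ : EuclideanSpace ℝ (Fin n)) :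
    ∃ x : ℝ → EuclideanSpace ℝ (Fin n),
      IsLipschitzSolution
        (fun t ξ => {v | ∃ σ : Fin m → ℝ,
          (∀ i, σ i ∈ sgnSet ⟪c i, ξ⟫) ∧
          v = f t ξ - ∑ i, σ i • (mv (A i) ξ + α • c i)}) T x₀ x ∧
      ∀ y : ℝ → EuclideanSpace ℝ (Fin n),
        IsLipschitzSolution
          (fun t ξ => {v | ∃ σ : Fin m → ℝ,
            (∀ i, σ i ∈ sgnSet ⟪c i, ξ⟫) ∧
            v = f t ξ - ∑ i, σ i • (mv (A i) ξ + α • c i)}) T x₀ y →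
        ∀ t ∈ Icc (0 : ℝ) T, y t = x t := by
  obtain ⟨L, hL0, hL⟩ := hfII
  choose a ha using fun i => kernel_factor (A i) (c i) (hKer i)
  let π : ℝ → ℝ := fun t => max 0 (min t T)
  have hπc : Continuous π := by fun_prop
  have hπm : ∀ t, π t ∈ Icc 0 T := fun t =>
    ⟨le_max_left _ _, max_le hT.le (min_le_right _ _)⟩
  have hπe : ∀ t ∈ Icc 0 T, π t = t := fun t ht => by simp [π, ht.1, ht.2]
  let g : ℝ → EuclideanSpace ℝ (Fin n) → EuclideanSpace ℝ (Fin n) := fun t x =>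
    f (π t) x - ∑ i, |⟪c i, x⟫| • a i
  let L' : ℝ≥0 := ⟨L, hL0⟩ + ∑ i, ‖c i‖₊ * ‖a i‖₊
  have hglip : ∀ t, LipschitzWith L' (g t) := by
    intro t
    refine LipschitzWith.sub (LipschitzWith.of_dist_le_mul fun x y => ?_)
      (LipschitzWith.of_dist_le_mul fun x y => ?_)
    · rw [dist_eq_norm, dist_eq_norm]
      exact hL _ (hπm t) x y
    · rw [dist_eq_norm, dist_eq_norm, ← Finset.sum_sub_distrib]
      push_cast
      rw [Finset.sum_mul]
      refine (norm_sum_le _ _).trans (Finset.sum_le_sum fun i _ => ?_)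
      rw [← sub_smul, norm_smul, Real.norm_eq_abs]
      have h1 := abs_abs_sub_abs_le_abs_sub ⟪c i, x⟫ ⟪c i, y⟫
      have h2 : |⟪c i, x⟫ - ⟪c i, y⟫| ≤ ‖c i‖ * ‖x - y‖ := by
        rw [← inner_sub_right]
        exact abs_real_inner_le_norm _ _
      calc _ ≤ (‖c i‖ * ‖x - y‖) * ‖a i‖ := by
            gcongr
            exact h1.trans h2
        _ = _ := by ring
  have hgc : ∀ x, Continuous fun t => g t x := fun x =>
    ((hfIII.1 x).continuous.comp hπc).sub continuous_const
  have hform : ∀ t ∈ Icc 0 T, ∀ (ξ : EuclideanSpace ℝ (Fin n)) (σ : Fin m → ℝ),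
      (∀ i, σ i ∈ sgnSet ⟪c i, ξ⟫) →
      f t ξ - ∑ i, σ i • (mv (A i) ξ + α • c i) = g t ξ - ∑ i, σ i • (α • c i) := by
    intro t ht ξ σ hσ
    simp only [g, hπe t ht, smul_add, Finset.sum_add_distrib]
    rw [sub_sub]
    congr 2
    refine Finset.sum_congr rfl fun i _ => ?_
    rw [ha, smul_smul, (sgnSet_subset (hσ i)).2]
  obtain ⟨x, ⟨K, hxK⟩, hx0, hxd⟩ := exists_sol hT L' g hglip hgc hα c x₀
  refine ⟨x, ⟨⟨K, hxK⟩, hx0, ?_⟩, ?_⟩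
  · filter_upwards [hxd] with t ht hmem
    obtain ⟨σ, hσ, hd⟩ := ht hmem
    exact ⟨_, ⟨σ, hσ, (hform t (Ioo_subset_Icc_self hmem) _ σ hσ).symm⟩, hd⟩
  · rintro y ⟨⟨K₂, hyK⟩, hy0, hyd⟩ t ht
    have hcomp := compare_curves (L := L') (ε := 0) L'.2 le_rfl hyK hxK (hy0.trans hx0.symm) (by
      filter_upwards [hxd, hyd] with s hs1 hs2 hmem
      obtain ⟨σ, hσ, hd⟩ := hs1 hmem
      obtain ⟨w, ⟨τ, hτ, hw⟩, hd'⟩ := hs2 hmem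
      refine ⟨_, _, hd', hd, ?_⟩
      rw [hw, hform s (Ioo_subset_Icc_self hmem) _ τ hτ]
      have e : g s (y s) - ∑ i, τ i • (α • c i) - (g s (x s) - ∑ i, σ i • (α • c i)) =
          (g s (y s) - g s (x s)) - ∑ i, (τ i - σ i) • (α • c i) := by
        simp only [sub_smul, Finset.sum_sub_distrib]
        abel
      rw [e, inner_sub_left, sum_inner]
      have h1 : ⟪g s (y s) - g s (x s), y s - x s⟫ ≤ L' * ‖y s - x s‖ ^ 2 := by
        refine (real_inner_le_norm _ _).trans ?_
        rw [sq, ← mul_assoc]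
        gcongr
        exact (hglip s).norm_sub_le _ _
      have h2 : 0 ≤ ∑ i, ⟪(τ i - σ i) • (α • c i), y s - x s⟫ := by
        refine Finset.sum_nonneg fun i _ => ?_
        rw [real_inner_smul_left, real_inner_smul_left, inner_sub_right]
        have := mul_nonneg hα.le (sgnSet_mono (hτ i) (hσ i))
        linarith
      linarith) ht
    have h0 : ‖y t - x t‖ ^ 2 ≤ 0 := by simpa using hcomp
    have h1 : ‖y t - x t‖ = 0 := by
      have := sq_nonneg ‖y t - x t‖
      exact pow_eq_zero_iff (two_ne_zero) |>.1 (le_antisymm h0 this)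
    exact sub_eq_zero.1 (norm_eq_zero.1 h1)
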